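/- Let r ≥ 1 and n ≥ 1 be integers with n ≥ 2r − 2. Then the probability that a random lattice path of length n has exactly r zeros equals (2^r/(n+1)) · (C(⌈n/2⌉,r)/C(n,r)) · ( 2⌈n/2⌉/(r(r+1)) + (r−1)/(r+1) + [n even]/r ) + [n even] · (2^{r−1}(r−1)/((n+1)·r)) · (C(n/2, r−1)/C(n,r)); i.e. (1/(n+1)) Σ_{ℓ=0}^{n} (1/C(n,ℓ)) · #{w ∈ P(n,ℓ) : Z(w) = r} equals this expression. Moreover, if 1 ≤ n < 2r − 2 this probability is 0, and for n = 0 it equals [r = 1]. -/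

import Mathlib

/-- The step value of a lattice path: `true` is an up-step (+1), `false` a down-step (−1). -/
def pathStep (b : Bool) : ℤ := if b then 1 else -1

/-- Partial sum `s_t(w) = Σ_{i<t} w(i)` of a lattice path of length `n`. -/
def psum {n : ℕ} (w : Fin n → Bool) (t : ℕ) : ℤ :=
  ∑ i ∈ Finset.univ.filter (fun i : Fin n => (i : ℕ) < t), pathStep (w i)

/-- `P(n,ℓ)`: lattice paths of length `n` with exactly `ℓ` down-steps. -/
def paths (n ℓ : ℕ) : Finset (Fin n → Bool) :=
  Finset.univ.filter (fun w => (Finset.univ.filter (fun i => w i = false)).card = ℓ)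

/-- `Z(w)`: the number of zeros of the lattice path `w`. -/
def numZeros {n : ℕ} (w : Fin n → Bool) : ℕ :=
  ((Finset.range (n + 1)).filter (fun t => psum w t = 0)).card

/-- The probability that a random lattice path of length `n` has exactly `r` zeros. -/
noncomputable def probZeros (n r : ℕ) : ℝ :=
  (1 / ((n : ℝ) + 1)) * ∑ ℓ ∈ Finset.range (n + 1),
    (1 / (n.choose ℓ : ℝ)) * (((paths n ℓ).filter (fun w => numZeros w = r)).card : ℝ)

open Finset in
/-- The number of paths of length `n` with `ℓ` down-steps and `z` zeros. -/
def zeroCount (n ℓ z : ℕ) : ℕ := #{w ∈ paths n ℓ | numZeros w = z}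

/-- The number of down-steps of a path. -/
def downSteps {n : ℕ} (w : Fin n → Bool) : ℕ :=
  (Finset.univ.filter (fun i => w i = false)).card

/-- The ballot numbers `C(a+c-1, c) - C(a+c-1, c-1)`. -/
def ballotNumber : ℕ → ℕ → ℤ
  | _, 0 => 1
  | a, c + 1 => (a + c).choose (c + 1) - (a + c).choose c

lemma ballotNumber_succ_succ (a c : ℕ) :
    ballotNumber (a + 1) (c + 1) = ballotNumber a (c + 1) + ballotNumber (a + 1) c := by
  cases c with
  | zero => simp [ballotNumber]
  | succ c =>
    simp only [ballotNumber]
    have h1 := Nat.choose_succ_succ (a + c + 1) (c + 1)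
    have h2 := Nat.choose_succ_succ (a + c + 1) c
    simp only [Nat.succ_eq_add_one] at h1 h2
    rw [show a + 1 + (c + 1) = a + c + 1 + 1 by ring, show a + (c + 1) = a + c + 1 by ring,
      show a + 1 + c = a + c + 1 by ring, h1, h2]
    push_cast
    ring

lemma ballotNumber_self_succ (c : ℕ) : ballotNumber (c + 1) (c + 1) = 0 := by
  have h := Nat.choose_symm_half c
  simp only [ballotNumber]
  rw [show c + 1 + c = 2 * c + 1 by ring, h, sub_self]

lemma ballotNumber_mul_add (a c : ℕ) :
    ballotNumber a c * (a + c) = (a - c) * ((a + c).choose c : ℤ) := by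
  cases c with
  | zero => simp [ballotNumber]
  | succ c =>
    have h1 := Nat.choose_succ_right_eq (a + c) c
    have h2 := Nat.choose_succ_succ (a + c) c
    rw [show a + c - c = a by omega] at h1
    simp only [Nat.succ_eq_add_one] at h2
    simp only [ballotNumber]
    rw [show a + (c + 1) = a + c + 1 by ring, h2]
    zify at h1
    push_cast
    linear_combination 2 * h1

lemma psum_eq_sum_ite {n : ℕ} (w : Fin n → Bool) (t : ℕ) :
    psum w t = ∑ i : Fin n, if (i : ℕ) < t then pathStep (w i) else 0 := by
  rw [psum, Finset.sum_filter]

lemma psum_length {n : ℕ} (w : Fin n → Bool) : psum w n = n - 2 * downSteps w := by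
  have h : ∀ b : Bool, pathStep b = 1 - 2 * (if b = false then 1 else 0) := by decide
  simp only [psum_eq_sum_ite, Fin.is_lt, if_true, h, Finset.sum_sub_distrib, ← Finset.mul_sum,
    downSteps, Finset.card_filter]
  simp

lemma psum_snoc {n : ℕ} (w : Fin n → Bool) (b : Bool) {t : ℕ} (ht : t ≤ n) :
    psum (Fin.snoc w b : Fin (n + 1) → Bool) t = psum w t := by
  simp only [psum_eq_sum_ite, Fin.sum_univ_castSucc, Fin.snoc_castSucc, Fin.snoc_last,
    Fin.val_castSucc, Fin.val_last, if_neg (not_lt.2 ht), add_zero]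

lemma downSteps_snoc {n : ℕ} (w : Fin n → Bool) (b : Bool) :
    downSteps (Fin.snoc w b : Fin (n + 1) → Bool) = downSteps w + if b = false then 1 else 0 := by
  simp only [downSteps, Finset.card_filter, Fin.sum_univ_castSucc, Fin.snoc_castSucc,
    Fin.snoc_last]

lemma numZeros_snoc {n : ℕ} (w : Fin n → Bool) (b : Bool) :
    numZeros (Fin.snoc w b : Fin (n + 1) → Bool) = numZeros w +
      if n + 1 = 2 * downSteps (Fin.snoc w b : Fin (n + 1) → Bool) then 1 else 0 := by
  have h := psum_length (Fin.snoc w b : Fin (n + 1) → Bool)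
  simp only [numZeros, Finset.card_filter]
  rw [Finset.sum_range_succ, h]
  congr 1
  · refine Finset.sum_congr rfl fun t ht => ?_
    rw [psum_snoc w b (by simpa [Nat.lt_succ_iff] using ht)]
  · refine if_congr ?_ rfl rfl
    push_cast
    omega

lemma numZeros_pos {n : ℕ} (w : Fin n → Bool) : 0 < numZeros w :=
  Finset.card_pos.2 ⟨0, Finset.mem_filter.2 ⟨by simp, by simp [psum]⟩⟩

lemma zeroCount_zero (n ℓ : ℕ) : zeroCount n ℓ 0 = 0 := by
  simp [zeroCount, (numZeros_pos _).ne']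

lemma zeroCount_eq_sum (n ℓ z : ℕ) :
    zeroCount n ℓ z = ∑ w : Fin n → Bool, if downSteps w = ℓ ∧ numZeros w = z then 1 else 0 := by
  rw [zeroCount, paths, Finset.filter_filter, Finset.card_filter]
  rfl

lemma zeroCount_length_zero (z : ℕ) : zeroCount 0 0 z = if z = 1 then 1 else 0 := by
  have h : ∀ w : Fin 0 → Bool, numZeros w = 1 := by decide
  simp [zeroCount_eq_sum, downSteps, h, eq_comm (a := z)]

lemma sum_snoc {n : ℕ} (f : (Fin (n + 1) → Bool) → ℕ) :
    ∑ w, f w =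
      ∑ w : Fin n → Bool, f (Fin.snoc w true) + ∑ w : Fin n → Bool, f (Fin.snoc w false) := by
  rw [← (Fin.snocEquiv (fun _ : Fin (n + 1) => Bool)).sum_comp, Fintype.sum_prod_type,
    Fintype.sum_bool]
  rfl

lemma zeroCount_succ_zero (n z : ℕ) : zeroCount (n + 1) 0 z = zeroCount n 0 z := by
  simp only [zeroCount_eq_sum, sum_snoc, numZeros_snoc, downSteps_snoc]
  simp only [Bool.true_eq_false, if_true, if_false, add_zero, Nat.add_eq_zero_iff, one_ne_zero,
    and_false, false_and, Finset.sum_const_zero]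
  refine Finset.sum_congr rfl fun w _ => if_congr ?_ rfl rfl
  refine and_congr_right fun hw => ?_
  rw [hw, if_neg (by omega), add_zero]

lemma zeroCount_succ_succ_of_ne {n ℓ : ℕ} (h : n + 1 ≠ 2 * (ℓ + 1)) (z : ℕ) :
    zeroCount (n + 1) (ℓ + 1) z = zeroCount n (ℓ + 1) z + zeroCount n ℓ z := by
  simp only [zeroCount_eq_sum, sum_snoc, numZeros_snoc, downSteps_snoc]
  congr 1 <;> refine Finset.sum_congr rfl fun w _ => if_congr ?_ rfl rfl
  · simp only [Bool.true_eq_false, if_false, add_zero]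
    refine and_congr_right fun hw => ?_
    rw [hw, if_neg h, add_zero]
  · simp only [if_true, add_left_inj]
    refine and_congr_right fun hw => ?_
    rw [hw, if_neg h, add_zero]

lemma zeroCount_succ_succ_of_eq {n ℓ : ℕ} (h : n + 1 = 2 * (ℓ + 1)) (z : ℕ) :
    zeroCount (n + 1) (ℓ + 1) (z + 1) = zeroCount n (ℓ + 1) z + zeroCount n ℓ z := by
  simp only [zeroCount_eq_sum, sum_snoc, numZeros_snoc, downSteps_snoc]
  congr 1 <;> refine Finset.sum_congr rfl fun w _ => if_congr ?_ rfl rfl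
  · simp only [Bool.true_eq_false, if_false, add_zero]
    refine and_congr_right fun hw => ?_
    rw [hw, if_pos h, add_left_inj]
  · simp only [if_true, add_left_inj]
    refine and_congr_right fun hw => ?_
    rw [hw, if_pos h, add_left_inj]

lemma psum_not {n : ℕ} (w : Fin n → Bool) (t : ℕ) : psum (fun i => !w i) t = -psum w t := by
  have h : ∀ b : Bool, pathStep (!b) = -pathStep b := by decide
  simp only [psum, h, Finset.sum_neg_distrib]

lemma numZeros_not {n : ℕ} (w : Fin n → Bool) : numZeros (fun i => !w i) = numZeros w := by
  simp only [numZeros, psum_not, neg_eq_zero]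

lemma downSteps_not {n : ℕ} (w : Fin n → Bool) : downSteps (fun i => !w i) + downSteps w = n := by
  have h1 := psum_length (fun i => !w i)
  have h2 := psum_length w
  rw [psum_not] at h1
  omega

lemma zeroCount_symm (a b z : ℕ) : zeroCount (a + b) a z = zeroCount (a + b) b z := by
  simp only [zeroCount_eq_sum]
  have hinv : Function.Involutive (fun (w : Fin (a + b) → Bool) i => !w i) := fun w => by simp
  rw [← Equiv.sum_comp hinv.toPerm]
  refine Finset.sum_congr rfl fun w _ => if_congr ?_ rfl rfl
  have h := downSteps_not w
  simp only [Function.Involutive.coe_toPerm, numZeros_not]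
  refine and_congr_left fun _ => ?_
  omega

/-- The first-return decomposition in numbers: `k + 1` zeros, `a` up-steps and `b ≤ a` down-steps
leave `2 ^ k` times a ballot number of paths. -/
lemma zeroCount_eq_ballotNumber {a b : ℕ} (hba : b ≤ a) (k : ℕ) :
    (zeroCount (a + b) b (k + 1) : ℤ) = if b < k then 0 else 2 ^ k * ballotNumber a (b - k) := by
  induction hn : a + b generalizing a b k with
  | zero =>
    obtain ⟨rfl, rfl⟩ : a = 0 ∧ b = 0 := by omega
    rw [zeroCount_length_zero]
    cases k <;> simp [ballotNumber]
  | succ n ih =>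
    obtain ⟨a, rfl⟩ : ∃ a', a = a' + 1 := ⟨a - 1, by omega⟩
    cases b with
    | zero =>
      have h := ih (a := a) (b := 0) (by omega) k (by omega)
      rw [zeroCount_succ_zero, h]
      simp [ballotNumber]
    | succ b =>
      rcases hba.eq_or_lt with hab | hab
      · obtain rfl : b = a := by omega
        rw [zeroCount_succ_succ_of_eq (by omega)]
        cases k with
        | zero => simp [zeroCount_zero, ballotNumber_self_succ]
        | succ k =>
          have h := ih (a := b + 1) (b := b) (by omega) k (by omega)
          have hs := zeroCount_symm (b + 1) b (k + 1)
          rw [show b + 1 + b = n by omega] at hs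
          rw [hs]
          push_cast
          rw [h]
          simp only [add_lt_add_iff_right]
          split_ifs <;> ring
      · rw [zeroCount_succ_succ_of_ne (by omega)]
        push_cast
        rw [ih (a := a) (b := b + 1) (by omega) k (by omega),
          ih (a := a + 1) (b := b) (by omega) k (by omega)]
        rcases lt_trichotomy (b + 1) k with hk | hk | hk
        · rw [if_pos hk, if_pos (by omega), if_pos hk, add_zero]
        · simp [← hk, ballotNumber]
        · rw [if_neg (by omega), if_neg (by omega), if_neg (by omega),
            show b + 1 - k = b - k + 1 by omega, ballotNumber_succ_succ]
          ring

/-- The conditional probability of `k + 1` zeros given `ℓ` down-steps, at most half of all. -/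
lemma zeroCount_div_choose {n ℓ k : ℕ} (hℓ : 2 * ℓ ≤ n) (hk : k < n) :
    1 / (n.choose ℓ : ℝ) * (zeroCount n ℓ (k + 1) : ℝ) =
      2 ^ k / (((k : ℝ) + 1) * (n.choose (k + 1) : ℝ)) *
        (((n : ℝ) + k - 2 * ℓ) * (ℓ.choose k : ℝ)) := by
  obtain ⟨a, rfl⟩ : ∃ a, n = a + ℓ := ⟨n - ℓ, by omega⟩
  have hz := zeroCount_eq_ballotNumber (a := a) (b := ℓ) (by omega) k
  have hc1 : ((a + ℓ).choose ℓ : ℝ) ≠ 0 := by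
    exact_mod_cast (Nat.choose_pos (by omega)).ne'
  have hc2 : ((a + ℓ).choose (k + 1) : ℝ) ≠ 0 := by
    exact_mod_cast (Nat.choose_pos (by omega)).ne'
  by_cases hℓk : ℓ < k
  · rw [if_pos hℓk] at hz
    rw [Nat.choose_eq_zero_of_lt hℓk, Int.natCast_eq_zero.1 hz]
    simp
  · rw [if_neg hℓk] at hz
    obtain ⟨c, rfl⟩ : ∃ c, ℓ = k + c := ⟨ℓ - k, by omega⟩
    rw [Nat.add_sub_cancel_left] at hz
    have hb := ballotNumber_mul_add a c
    have hm := Nat.choose_mul (n := a + (k + c)) (k := k + c) (s := k) (by omega)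
    have hs := Nat.choose_succ_right_eq (a + (k + c)) k
    rw [show a + (k + c) - k = a + c by omega] at hm hs
    rw [Nat.add_sub_cancel_left] at hm
    have hz' : (zeroCount (a + (k + c)) (k + c) (k + 1) : ℝ) = 2 ^ k * (ballotNumber a c : ℝ) := by
      exact_mod_cast hz
    have hb' : (ballotNumber a c : ℝ) * (a + c) = (a - c) * ((a + c).choose c : ℝ) := by
      exact_mod_cast hb
    have hm' : ((a + (k + c)).choose (k + c) : ℝ) * ((k + c).choose k : ℝ)
        = ((a + (k + c)).choose k : ℝ) * ((a + c).choose c : ℝ) := by exact_mod_cast hm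
    have hs' : ((a + (k + c)).choose (k + 1) : ℝ) * ((k : ℝ) + 1)
        = ((a + (k + c)).choose k : ℝ) * ((a : ℝ) + c) := by exact_mod_cast hs
    have hk1 : (k : ℝ) + 1 ≠ 0 := by positivity
    rw [hz']
    field_simp
    push_cast
    linear_combination (ballotNumber a c : ℝ) * hs' +
      ((a + (k + c)).choose k : ℝ) * hb' - ((a : ℝ) - c) * hm'

lemma sum_range_mul_choose (x : ℝ) (k m : ℕ) :
    ((k : ℝ) + 2) * ∑ ℓ ∈ Finset.range m, (x - 2 * ℓ) * (ℓ.choose k : ℝ) =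
      (x * (k + 2) - 2 * ((k + 1) * m - 1)) * (m.choose (k + 1) : ℝ) := by
  induction m with
  | zero => simp
  | succ m ih =>
    have h1 := Nat.choose_succ_succ m k
    have h2 : (m.choose (k + 1) : ℝ) * (k + 1) = (m.choose k : ℝ) * ((m : ℝ) - k) := by
      rcases le_or_gt k m with h | h
      · have := Nat.choose_succ_right_eq m k
        rw [← Nat.cast_sub h]
        exact_mod_cast this
      · simp [Nat.choose_eq_zero_of_lt h, Nat.choose_eq_zero_of_lt (h.trans (Nat.lt_succ_self k))]
    rw [Finset.sum_range_succ, mul_add, ih, h1]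
    push_cast
    linear_combination 2 * h2

lemma probZeros_eq (n z : ℕ) : probZeros n z = 1 / ((n : ℝ) + 1) *
    ∑ ℓ ∈ Finset.range (n + 1), 1 / (n.choose ℓ : ℝ) * (zeroCount n ℓ z : ℝ) := rfl

lemma sum_zeroCount_tail (n m z j : ℕ) (h : m + j = n + 1) :
    ∑ i ∈ Finset.range m, 1 / (n.choose (j + i) : ℝ) * (zeroCount n (j + i) z : ℝ) =
      ∑ ℓ ∈ Finset.range m, 1 / (n.choose ℓ : ℝ) * (zeroCount n ℓ z : ℝ) := by
  rw [← Finset.sum_range_reflect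
    (fun i => 1 / (n.choose (j + i) : ℝ) * (zeroCount n (j + i) z : ℝ))]
  refine Finset.sum_congr rfl fun i hi => ?_
  have hi := Finset.mem_range.1 hi
  obtain ⟨q, rfl⟩ : ∃ q, n = q + i := ⟨n - i, by omega⟩
  rw [show j + (m - 1 - i) = q by omega, zeroCount_symm, Nat.choose_symm_add]

lemma sum_zeroCount_head {n m k : ℕ} (hm : 2 * m ≤ n + 1) (hk : k < n) :
    ∑ ℓ ∈ Finset.range m, 1 / (n.choose ℓ : ℝ) * (zeroCount n ℓ (k + 1) : ℝ) =
      2 ^ k / (((k : ℝ) + 1) * (n.choose (k + 1) : ℝ)) *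
        ∑ ℓ ∈ Finset.range m, ((n : ℝ) + k - 2 * ℓ) * (ℓ.choose k : ℝ) := by
  rw [Finset.mul_sum]
  refine Finset.sum_congr rfl fun ℓ hℓ => ?_
  have hℓ := Finset.mem_range.1 hℓ
  exact zeroCount_div_choose (by omega) hk

lemma probZeros_odd {m k : ℕ} (hk : k < 2 * m + 1) :
    probZeros (2 * m + 1) (k + 1) = 1 / (2 * (m : ℝ) + 2) * (2 *
      (2 ^ k / (((k : ℝ) + 1) * ((2 * m + 1).choose (k + 1) : ℝ)) *
        ∑ ℓ ∈ Finset.range (m + 1), (2 * (m : ℝ) + 1 + k - 2 * ℓ) * (ℓ.choose k : ℝ))) := by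
  rw [probZeros_eq, show 2 * m + 1 + 1 = (m + 1) + (m + 1) by ring, Finset.sum_range_add,
    sum_zeroCount_tail _ _ _ _ (by ring), sum_zeroCount_head (by omega) hk]
  push_cast
  ring

lemma probZeros_even {m k : ℕ} (hk : k < 2 * m) :
    probZeros (2 * m) (k + 1) = 1 / (2 * (m : ℝ) + 1) *
      (2 ^ k / (((k : ℝ) + 1) * ((2 * m).choose (k + 1) : ℝ)) *
        (2 * (∑ ℓ ∈ Finset.range m, (2 * (m : ℝ) + k - 2 * ℓ) * (ℓ.choose k : ℝ)) +
          k * (m.choose k : ℝ))) := by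
  rw [probZeros_eq, show 2 * m + 1 = (m + 1) + m by ring, Finset.sum_range_add,
    sum_zeroCount_tail _ _ _ _ (by ring), Finset.sum_range_succ,
    zeroCount_div_choose le_rfl hk, sum_zeroCount_head (by omega) hk]
  push_cast
  ring

lemma probZeros_eq_zero {n k : ℕ} (h : n < 2 * k) : probZeros n (k + 1) = 0 := by
  rw [probZeros_eq, Finset.sum_eq_zero, mul_zero]
  intro ℓ hℓ
  have key : ∀ a b : ℕ, b ≤ a → a + b = n → zeroCount n b (k + 1) = 0 := by
    rintro a b hba rfl
    have := zeroCount_eq_ballotNumber hba k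
    rw [if_pos (by omega)] at this
    exact_mod_cast this
  have hℓ := Finset.mem_range.1 hℓ
  obtain ⟨a, rfl⟩ : ∃ a, n = a + ℓ := ⟨n - ℓ, by omega⟩
  suffices hz : zeroCount (a + ℓ) ℓ (k + 1) = 0 by simp [hz]
  rcases le_total ℓ a with h' | h'
  · exact key a ℓ h' rfl
  · rw [← zeroCount_symm]
    exact key ℓ a h' (by ring)

/-- The exact distribution of the number of zeros. For `r ≥ 1` and `n ≥ 1` with
`n ≥ 2r−2` the probability of exactly `r` zeros is the displayed expression
(`⌈n/2⌉ = (n+1)/2` in natural division); for `1 ≤ n < 2r−2` it is `0`; and for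
`n = 0` it is `[r = 1]`. -/
theorem distribution_of_zeros (r : ℕ) (hr : 1 ≤ r) (n : ℕ) :
    ((1 ≤ n → 2 * r - 2 ≤ n →
      probZeros n r
        = ((2 : ℝ) ^ r / ((n : ℝ) + 1)) * ((((n + 1) / 2).choose r : ℝ) / (n.choose r : ℝ)) *
            (2 * (((n + 1) / 2 : ℕ) : ℝ) / ((r : ℝ) * ((r : ℝ) + 1))
              + ((r : ℝ) - 1) / ((r : ℝ) + 1)
              + (if Even n then 1 / (r : ℝ) else 0))
          + (if Even n then
              ((2 : ℝ) ^ (r - 1) * ((r : ℝ) - 1) / (((n : ℝ) + 1) * (r : ℝ))) *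
                (((n / 2).choose (r - 1) : ℝ) / (n.choose r : ℝ))
            else 0)))
    ∧ (1 ≤ n → n < 2 * r - 2 → probZeros n r = 0)
    ∧ (n = 0 → probZeros n r = if r = 1 then 1 else 0) := by
  obtain ⟨k, rfl⟩ : ∃ k, r = k + 1 := ⟨r - 1, by omega⟩
  refine ⟨fun hn hrn => ?_, fun _ hrn => probZeros_eq_zero (by omega), ?_⟩
  · have hc : (n.choose (k + 1) : ℝ) ≠ 0 := by
      exact_mod_cast (Nat.choose_pos (by omega)).ne'
    have hk1 : (k : ℝ) + 1 ≠ 0 := by positivity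
    have hk2 : (k : ℝ) + 2 ≠ 0 := by positivity
    rcases Nat.even_or_odd' n with ⟨m, rfl | rfl⟩
    · have he : Even (2 * m) := even_two_mul m
      rw [if_pos he, if_pos he, probZeros_even (by omega), show (2 * m + 1) / 2 = m by omega,
        show 2 * m / 2 = m by omega, Nat.add_sub_cancel]
      have hs := sum_range_mul_choose (2 * (m : ℝ) + k) k m
      rw [mul_comm, ← eq_div_iff hk2] at hs
      rw [hs]
      have hm : 2 * (m : ℝ) + 1 ≠ 0 := by positivity
      push_cast
      field_simp
      ring
    · have he : ¬ Even (2 * m + 1) := Nat.not_even_two_mul_add_one m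
      rw [if_neg he, if_neg he, probZeros_odd (by omega), show (2 * m + 1 + 1) / 2 = m + 1 by omega]
      have hs := sum_range_mul_choose (2 * (m : ℝ) + 1 + k) k (m + 1)
      rw [mul_comm, ← eq_div_iff hk2] at hs
      rw [hs]
      have hm : (m : ℝ) + 1 ≠ 0 := by positivity
      push_cast
      field_simp
      ring
  · rintro rfl
    simp [probZeros_eq, zeroCount_length_zero]
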